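/- Let k ≥ 2, 2 ≤ j ≤ k, p ∈ (0,1) and ℓ ≥ 1, and set δ(ℓ) = g_p^{∘ℓ}(p)/p. If (ℓ+1)·δ(ℓ) ≤ 1/4, then for every depth n ≥ 0 and every f : Ω_n → ℝ the Poincaré inequality Var_μ(f) ≤ 8 · ∑_{x ∈ V_n} μ( c_x^{(ℓ)} · Var_x(f) ) holds, where c_x^{(ℓ)} is the long-range constraint defined via ℓ steps of oriented bootstrap. In particular the constant 8 is independent of n. -/

import Mathlib

open scoped Classical

noncomputable section

/-- The bootstrap recursion map `g_p(x) = p·∑_{i=k-j+1}^{k} C(k,i) xⁱ (1-x)^{k-i}`. -/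
def g (k j : ℕ) (p x : ℝ) : ℝ :=
  p * ∑ i ∈ Finset.Icc (k - j + 1) k, (Nat.choose k i : ℝ) * x ^ i * (1 - x) ^ (k - i)

section Bernoulli

variable {V : Type*} [Fintype V] [DecidableEq V]

/-- Bernoulli(p) product weight of a configuration (`true` = occupied, with probability `p`). -/
def wt (p : ℝ) (η : V → Bool) : ℝ := ∏ x : V, if η x then p else 1 - p

/-- Expectation under the Bernoulli(p) product measure μ. -/
def mean (p : ℝ) (f : (V → Bool) → ℝ) : ℝ := ∑ η : V → Bool, wt p η * f η

/-- Probability of an event under the Bernoulli(p) product measure μ. -/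
def probEv (p : ℝ) (E : (V → Bool) → Prop) : ℝ := mean p (fun η => if E η then 1 else 0)

/-- Conditional expectation `μ_A(f)` of `f` given the coordinates outside `A`. -/
def cexp (p : ℝ) (A : Finset V) (f : (V → Bool) → ℝ) (η : V → Bool) : ℝ :=
  ∑ ζ : V → Bool,
    (∏ x : V, if x ∈ A then (if ζ x then p else 1 - p) else (if ζ x = η x then 1 else 0)) * f ζ

/-- Conditional variance `Var_A(f)` on the coordinates of `A` given the remaining coordinates. -/
def cvar (p : ℝ) (A : Finset V) (f : (V → Bool) → ℝ) (η : V → Bool) : ℝ :=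
  cexp p A (fun ζ => f ζ ^ 2) η - (cexp p A f η) ^ 2

/-- Variance `Var_μ(f)` under the Bernoulli(p) product measure. -/
def varTot (p : ℝ) (f : (V → Bool) → ℝ) : ℝ := mean p (fun η => f η ^ 2) - (mean p f) ^ 2

end Bernoulli

/-- Vertices of the rooted `k`-ary tree of depth `n`: words of length `≤ n` over `Fin k`. -/
abbrev TV (k n : ℕ) := Σ m : Fin (n + 1), Fin m.val → Fin k

/-- The root: the empty word. -/
def rootT (k n : ℕ) : TV k n := ⟨⟨0, Nat.succ_pos n⟩, Fin.elim0⟩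

/-- `y` is a child of `x` in the rooted tree. -/
def childOf {k n : ℕ} (x y : TV k n) : Prop :=
  ∃ h : y.1.val = x.1.val + 1, ∀ i : Fin x.1.val, y.2 (Fin.cast h.symm i.castSucc) = x.2 i

/-- The oriented bootstrap map `B̄`: a vertex becomes empty iff it is already empty or
at least `j` of its children are empty. -/
def bootO {k n : ℕ} (j : ℕ) (η : TV k n → Bool) : TV k n → Bool := fun x =>
  if η x = false ∨ j ≤ (Finset.univ.filter fun y : TV k n => childOf x y ∧ η y = false).card
  then false else true

/-- The long-range constraint `c_x^{(ℓ)}`: identically `1` if the subtree below `x` has depth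
`< ℓ`; otherwise `1` iff `x` can be emptied within `ℓ` steps of the oriented bootstrap map
applied to the configuration set to occupied at `x`. -/
def cEll {k n : ℕ} (j ℓ : ℕ) (x : TV k n) (η : TV k n → Bool) : ℝ :=
  if n - x.1.val < ℓ then 1
  else if (bootO j)^[ℓ] (Function.update η x true) x = false then 1 else 0

section Bernoulli

variable {V : Type*} [Fintype V] [DecidableEq V] {p : ℝ}

theorem cexp_cexp (A B : Finset V) (f : (V → Bool) → ℝ) :
    cexp p A (cexp p B f) = cexp p (A ∪ B) f := by
  funext η
  simp only [cexp, Finset.mul_sum]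
  rw [Finset.sum_comm]
  refine Finset.sum_congr rfl fun ξ _ => ?_
  simp only [← mul_assoc, ← Finset.sum_mul, ← Finset.prod_mul_distrib]
  congr 1
  rw [← Fintype.piFinset_univ, ← Finset.prod_univ_sum (fun _ => Finset.univ)
    (fun x b => (if x ∈ A then (if b then p else 1 - p) else (if b = η x then 1 else 0)) *
      (if x ∈ B then (if ξ x then p else 1 - p) else (if ξ x = b then 1 else 0)))]
  refine Finset.prod_congr rfl fun x _ => ?_
  by_cases hA : x ∈ A <;> by_cases hB : x ∈ B <;> cases η x <;> cases ξ x <;> simp [hA, hB] <;> ring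

theorem cexp_univ (f : (V → Bool) → ℝ) (η : V → Bool) :
    cexp p Finset.univ f η = mean p f := by
  simp [cexp, mean, wt]

theorem cexp_mul_of_dependsOn {A : Finset V} {c : (V → Bool) → ℝ}
    (hc : DependsOn c (↑A : Set V)ᶜ) (f : (V → Bool) → ℝ) (η : V → Bool) :
    cexp p A (fun ζ => c ζ * f ζ) η = c η * cexp p A f η := by
  simp only [cexp, Finset.mul_sum]
  refine Finset.sum_congr rfl fun ζ _ => ?_
  by_cases h : ∀ x ∉ A, ζ x = η x
  · rw [hc (x := ζ) (y := η) fun x hx => h x (by simpa using hx)]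
    ring
  · push Not at h
    obtain ⟨x, hxA, hx⟩ := h
    rw [Finset.prod_eq_zero (Finset.mem_univ x) (by simp [hxA, hx])]
    ring

theorem cexp_one (A : Finset V) (η : V → Bool) : cexp p A (fun _ => 1) η = 1 := by
  simp only [cexp, mul_one]
  rw [← Fintype.piFinset_univ, ← Finset.prod_univ_sum (fun _ => Finset.univ)
    (fun x b => if x ∈ A then (if b then p else 1 - p) else (if b = η x then (1 : ℝ) else 0))]
  refine Finset.prod_eq_one fun x _ => ?_
  by_cases hA : x ∈ A <;> cases η x <;> simp [hA]

theorem cexp_of_dependsOn {A : Finset V} {c : (V → Bool) → ℝ}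
    (hc : DependsOn c (↑A : Set V)ᶜ) : cexp p A c = c := by
  funext η
  simpa [cexp_one] using cexp_mul_of_dependsOn (p := p) hc (fun _ => 1) η

theorem cexp_empty (f : (V → Bool) → ℝ) : cexp p ∅ f = f :=
  cexp_of_dependsOn (by simpa using dependsOn_univ f)

theorem cexp_sub (A : Finset V) (f h : (V → Bool) → ℝ) (η : V → Bool) :
    cexp p A (fun ζ => f ζ - h ζ) η = cexp p A f η - cexp p A h η := by
  simp [cexp, mul_sub]

theorem cexp_add (A : Finset V) (f h : (V → Bool) → ℝ) (η : V → Bool) :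
    cexp p A (fun ζ => f ζ + h ζ) η = cexp p A f η + cexp p A h η := by
  simp [cexp, mul_add, Finset.sum_add_distrib]

theorem dependsOn_cexp (A : Finset V) (f : (V → Bool) → ℝ) :
    DependsOn (cexp p A f) (↑A : Set V)ᶜ := by
  intro η η' h
  refine Finset.sum_congr rfl fun ζ _ => ?_
  congr 1
  refine Finset.prod_congr rfl fun x _ => ?_
  by_cases hx : x ∈ A
  · simp [hx]
  · simp [hx, h x (by simpa using hx)]

theorem mean_cexp (A : Finset V) (f : (V → Bool) → ℝ) : mean p (cexp p A f) = mean p f := by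
  have h := cexp_cexp (p := p) Finset.univ A f
  rw [Finset.union_eq_left.2 (Finset.subset_univ A)] at h
  simpa [cexp_univ] using congrFun h fun _ => true

theorem cexp_eq_mean {A : Finset V} {F : (V → Bool) → ℝ} (hF : DependsOn F (↑A : Set V))
    (η : V → Bool) : cexp p A F η = mean p F := by
  have h : cexp p Aᶜ F = F := cexp_of_dependsOn (by simpa using hF)
  rw [← cexp_univ F η, ← Finset.union_compl A, ← cexp_cexp, h]

theorem mean_mul_of_dependsOn {A : Finset V} {F G : (V → Bool) → ℝ}
    (hF : DependsOn F (↑A : Set V)) (hG : DependsOn G (↑A : Set V)ᶜ) :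
    mean p (fun η => G η * F η) = mean p G * mean p F := by
  rw [← mean_cexp A]
  simp only [mean, Finset.sum_mul]
  refine Finset.sum_congr rfl fun η _ => ?_
  rw [cexp_mul_of_dependsOn hG, cexp_eq_mean hF, mean]
  ring

theorem mean_const (a : ℝ) : mean p (fun _ : V → Bool => a) = a := by
  have h : mean p (fun _ : V → Bool => 1) = 1 := by
    rw [← cexp_univ _ (fun _ => true), cexp_one]
  rw [mean] at h ⊢
  rw [← Finset.sum_mul]
  simp only [mul_one] at h
  rw [h, one_mul]

theorem mean_prod_of_dependsOn {ι : Type*} [DecidableEq ι] (s : Finset ι) (A : ι → Finset V)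
    (F : ι → (V → Bool) → ℝ) (hF : ∀ i ∈ s, DependsOn (F i) (↑(A i) : Set V))
    (hA : ∀ i ∈ s, ∀ i' ∈ s, i ≠ i' → Disjoint (A i) (A i')) :
    mean p (fun η => ∏ i ∈ s, F i η) = ∏ i ∈ s, mean p (F i) := by
  induction s using Finset.induction_on with
  | empty => simpa using mean_const (V := V) (p := p) 1
  | insert a s ha ih =>
    simp only [Finset.prod_insert ha]
    rw [← ih (fun i hi => hF i (Finset.mem_insert_of_mem hi)) (fun i hi i' hi' =>
      hA i (Finset.mem_insert_of_mem hi) i' (Finset.mem_insert_of_mem hi')), mul_comm (mean p _),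
      ← mean_mul_of_dependsOn (hF a (Finset.mem_insert_self a s))]
    · simp only [mul_comm]
    · intro η η' h
      refine Finset.prod_congr rfl fun i hi => hF i (Finset.mem_insert_of_mem hi) fun x hx => ?_
      refine h x fun hxa => ?_
      exact Finset.disjoint_left.1 (hA a (Finset.mem_insert_self a s) i
        (Finset.mem_insert_of_mem hi) (by rintro rfl; exact ha hi)) hxa hx

theorem mean_coordinate (x : V) : mean p (fun η => if η x then 1 else 0) = p := by
  have h : ∀ η : V → Bool, wt p η * (if η x then 1 else 0) =
      ∏ y, (if η y then p else 1 - p) * (if y = x then (if η y then 1 else 0) else 1) := by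
    intro η
    rw [Finset.prod_mul_distrib, Finset.prod_ite_eq' Finset.univ x]
    simp [wt]
  simp only [mean, h]
  rw [← Fintype.piFinset_univ, ← Finset.prod_univ_sum (fun _ => Finset.univ)
    (fun y (b : Bool) => (if b then p else 1 - p) * (if y = x then (if b then 1 else 0) else (1 : ℝ)))]
  rw [Finset.prod_eq_single x] <;> simp +contextual

/-- The probability that fewer than `j` of the events `X y`, `y ∈ s`, fail, when these events are
independent and have the same probability `q`. -/
theorem mean_card_failures_lt (s : Finset V) (A : V → Finset V) (X : V → (V → Bool) → Bool)
    (hX : ∀ y ∈ s, DependsOn (X y) (↑(A y) : Set V))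
    (hA : ∀ y ∈ s, ∀ y' ∈ s, y ≠ y' → Disjoint (A y) (A y')) {q : ℝ}
    (hq : ∀ y ∈ s, mean p (fun η => if X y η then 1 else 0) = q) {j : ℕ}
    (hjs : j ≤ s.card) :
    mean p (fun η => if (s.filter fun y => X y η = false).card < j then 1 else 0) =
      ∑ i ∈ Finset.Icc (s.card - j + 1) s.card,
        (Nat.choose s.card i : ℝ) * q ^ i * (1 - q) ^ (s.card - i) := by
  have hpt : ∀ η, (if (s.filter fun y => X y η = false).card < j then (1 : ℝ) else 0) =
      ∑ S ∈ s.powerset, (if s.card - S.card < j then 1 else 0) *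
        ∏ y ∈ s, (if y ∈ S then (if X y η then 1 else 0) else (if X y η then 0 else 1)) := by
    intro η
    rw [Finset.sum_eq_single (s.filter fun y => X y η = true)]
    · rw [Finset.prod_eq_one, mul_one]
      · have := Finset.card_filter_add_card_filter_not (s := s) (fun y => X y η = true)
        simp only [Bool.not_eq_true] at this
        congr 2
        omega
      · intro y hy
        cases h : X y η <;> simp [h, hy]
    · intro S hS hne
      rw [Finset.mem_powerset] at hS
      obtain ⟨y, hy⟩ : ∃ y, ¬ (y ∈ S ↔ y ∈ s.filter fun y => X y η = true) := by
        by_contra! hcon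
        exact hne (Finset.ext hcon)
      rw [Finset.mem_filter] at hy
      have hys : y ∈ s := by
        by_contra hys
        exact hy ⟨fun h => absurd (hS h) hys, fun h => absurd h.1 hys⟩
      rw [Finset.prod_eq_zero hys, mul_zero]
      by_cases hyS : y ∈ S <;> cases h : X y η <;> simp_all
    · simp
  have hterm : ∀ S ∈ s.powerset, mean p (fun η => ∏ y ∈ s, (if y ∈ S then
      (if X y η then (1 : ℝ) else 0) else (if X y η then 0 else 1))) =
      q ^ S.card * (1 - q) ^ (s.card - S.card) := by
    intro S hS
    rw [Finset.mem_powerset] at hS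
    rw [mean_prod_of_dependsOn s A _ _ hA]
    · have : ∀ y ∈ s, mean p (fun η => if y ∈ S then
          (if X y η then (1 : ℝ) else 0) else (if X y η then 0 else 1)) =
          if y ∈ S then q else 1 - q := by
        intro y hy
        by_cases hyS : y ∈ S
        · simp only [hyS, if_true, hq y hy]
        · simp only [hyS, if_false]
          rw [← hq y hy]
          refine Eq.trans ?_ (congrArg (· - _) (mean_const (V := V) (p := p) 1))
          simp only [mean, ← Finset.sum_sub_distrib, ← mul_sub]
          refine Finset.sum_congr rfl fun η _ => ?_
          cases X y η <;> simp
      rw [Finset.prod_congr rfl this, Finset.prod_ite]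
      simp only [Finset.prod_const]
      rw [Finset.filter_mem_eq_inter, Finset.inter_eq_right.2 hS,
        Finset.filter_notMem_eq_sdiff, Finset.card_sdiff_of_subset hS]
    · intro y hy η η' h
      simp only [hX y hy h]
  have hswap : mean p (fun η => ∑ S ∈ s.powerset, (if s.card - S.card < j then (1 : ℝ) else 0) *
        ∏ y ∈ s, (if y ∈ S then (if X y η then 1 else 0) else (if X y η then 0 else 1))) =
      ∑ S ∈ s.powerset, (if s.card - S.card < j then (1 : ℝ) else 0) *
        mean p (fun η => ∏ y ∈ s, (if y ∈ S then
          (if X y η then (1 : ℝ) else 0) else (if X y η then 0 else 1))) := by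
    simp only [mean, Finset.mul_sum]
    rw [Finset.sum_comm]
    refine Finset.sum_congr rfl fun S _ => Finset.sum_congr rfl fun η _ => ?_
    ring
  simp only [hpt]
  rw [hswap, Finset.sum_congr rfl fun S hS => by rw [hterm S hS],
    Finset.sum_powerset_apply_card (fun i => (if s.card - i < j then (1 : ℝ) else 0) *
      (q ^ i * (1 - q) ^ (s.card - i)))]
  symm
  refine Finset.sum_subset_zero_on_sdiff ?_ ?_ ?_
  · intro i hi
    simp only [Finset.mem_Icc, Finset.mem_range] at hi ⊢
    omega
  · intro i hi
    simp only [Finset.mem_sdiff, Finset.mem_Icc, Finset.mem_range] at hi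
    have : ¬ s.card - i < j := by omega
    simp [this]
  · intro i hi
    rw [Finset.mem_Icc] at hi
    have : s.card - i < j := by omega
    simp [this, mul_assoc]

theorem wt_nonneg (hp0 : 0 ≤ p) (hp1 : p ≤ 1) (η : V → Bool) : 0 ≤ wt p η := by
  refine Finset.prod_nonneg fun x _ => ?_
  split_ifs <;> linarith

theorem mean_mono (hp0 : 0 ≤ p) (hp1 : p ≤ 1) {f h : (V → Bool) → ℝ} (hfh : ∀ η, f η ≤ h η) :
    mean p f ≤ mean p h :=
  Finset.sum_le_sum fun η _ => mul_le_mul_of_nonneg_left (hfh η) (wt_nonneg hp0 hp1 η)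

theorem mean_nonneg (hp0 : 0 ≤ p) (hp1 : p ≤ 1) {f : (V → Bool) → ℝ} (hf : ∀ η, 0 ≤ f η) :
    0 ≤ mean p f :=
  Finset.sum_nonneg fun η _ => mul_nonneg (wt_nonneg hp0 hp1 η) (hf η)

theorem mean_add (f h : (V → Bool) → ℝ) :
    mean p (fun η => f η + h η) = mean p f + mean p h := by
  simp [mean, mul_add, Finset.sum_add_distrib]

theorem mean_sub (f h : (V → Bool) → ℝ) :
    mean p (fun η => f η - h η) = mean p f - mean p h := by
  simp [mean, mul_sub]

theorem mean_const_mul (a : ℝ) (f : (V → Bool) → ℝ) :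
    mean p (fun η => a * f η) = a * mean p f := by
  simp only [mean, Finset.mul_sum]
  exact Finset.sum_congr rfl fun η _ => by ring

theorem cexp_mul_sq_le (hp0 : 0 ≤ p) (hp1 : p ≤ 1) (A : Finset V) (u v : (V → Bool) → ℝ)
    (η : V → Bool) :
    cexp p A (fun ζ => u ζ * v ζ) η ^ 2 ≤
      cexp p A (fun ζ => u ζ ^ 2) η * cexp p A (fun ζ => v ζ ^ 2) η := by
  have hw : ∀ ζ : V → Bool, 0 ≤ ∏ x : V, if x ∈ A then (if ζ x then p else 1 - p)
      else (if ζ x = η x then (1 : ℝ) else 0) := fun ζ => by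
    refine Finset.prod_nonneg fun x _ => ?_
    split_ifs <;> linarith
  refine Finset.sum_sq_le_sum_mul_sum_of_sq_le_mul _ (fun ζ _ => ?_) (fun ζ _ => ?_)
    fun ζ _ => ?_
  · exact mul_nonneg (hw ζ) (sq_nonneg _)
  · exact mul_nonneg (hw ζ) (sq_nonneg _)
  · exact le_of_eq (by ring)

theorem mean_cexp_sq_le (hp0 : 0 ≤ p) (hp1 : p ≤ 1) (A : Finset V) (f : (V → Bool) → ℝ) :
    mean p (fun η => cexp p A f η ^ 2) ≤ mean p (fun η => f η ^ 2) := by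
  rw [← mean_cexp A (fun η => f η ^ 2)]
  refine mean_mono hp0 hp1 fun η => ?_
  simpa [cexp_one] using cexp_mul_sq_le hp0 hp1 A (fun _ => 1) f η

theorem mean_mul_sq_sub_cexp {A : Finset V} {c : (V → Bool) → ℝ}
    (hc : DependsOn c (↑A : Set V)ᶜ) (f : (V → Bool) → ℝ) :
    mean p (fun η => c η * (f η - cexp p A f η) ^ 2) =
      mean p (fun η => c η * (cexp p A (fun ζ => f ζ ^ 2) η - cexp p A f η ^ 2)) := by
  have hcf : DependsOn (fun η => c η * cexp p A f η) (↑A : Set V)ᶜ := fun η η' h => by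
    simp only [hc h, dependsOn_cexp A f h]
  have hcross : mean p (fun η => c η * cexp p A f η * f η) =
      mean p (fun η => c η * cexp p A f η * cexp p A f η) := by
    rw [← mean_cexp A]
    exact congrArg (mean p) (funext fun η => cexp_mul_of_dependsOn hcf f η)
  have hsq : mean p (fun η => c η * f η ^ 2) =
      mean p (fun η => c η * cexp p A (fun ζ => f ζ ^ 2) η) := by
    rw [← mean_cexp A]
    exact congrArg (mean p) (funext fun η => cexp_mul_of_dependsOn hc (fun ζ => f ζ ^ 2) η)
  have hl : ∀ η, c η * (f η - cexp p A f η) ^ 2 = c η * f η ^ 2 -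
      2 * (c η * cexp p A f η * f η) + c η * cexp p A f η * cexp p A f η := fun η => by ring
  have hr : ∀ η, c η * (cexp p A (fun ζ => f ζ ^ 2) η - cexp p A f η ^ 2) =
      c η * cexp p A (fun ζ => f ζ ^ 2) η - c η * cexp p A f η * cexp p A f η := fun η => by ring
  simp only [hl, hr]
  rw [mean_add, mean_sub, mean_const_mul, mean_sub, hsq, hcross]
  ring

/-- The second moment `μ(μ_A(f)²)`. -/
def energy (p : ℝ) (f : (V → Bool) → ℝ) (A : Finset V) : ℝ := mean p (fun η => cexp p A f η ^ 2)

theorem varTot_eq_energy_sub (f : (V → Bool) → ℝ) :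
    varTot p f = energy p f ∅ - energy p f Finset.univ := by
  simp only [varTot, energy, cexp_empty, cexp_univ, mean_const]

theorem energy_sub_energy_union (f : (V → Bool) → ℝ) (A B : Finset V) :
    energy p f B - energy p f (B ∪ A) =
      mean p (fun η => cexp p B (fun ζ => f ζ - cexp p A f ζ) η ^ 2) := by
  have h := mean_mul_sq_sub_cexp (p := p) (A := A) (c := fun _ => 1) (fun _ _ _ => rfl)
    (cexp p B f)
  simp only [one_mul] at h
  rw [mean_sub, mean_cexp A (fun ζ => cexp p B f ζ ^ 2)] at h
  simp only [energy, cexp_sub, cexp_cexp] at h ⊢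
  rw [Finset.union_comm B A, h]

theorem energy_sub_energy_union_le (hp0 : 0 ≤ p) (hp1 : p ≤ 1) (f : (V → Bool) → ℝ)
    (A : Finset V) {B B' : Finset V} (hB : B' ⊆ B) :
    energy p f B - energy p f (B ∪ A) ≤ energy p f B' - energy p f (B' ∪ A) := by
  rw [energy_sub_energy_union, energy_sub_energy_union]
  conv_lhs => rw [← Finset.union_eq_left.2 hB, ← cexp_cexp]
  exact mean_cexp_sq_le hp0 hp1 _ _

theorem energy_antitone (hp0 : 0 ≤ p) (hp1 : p ≤ 1) (f : (V → Bool) → ℝ) {A B : Finset V}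
    (hB : A ⊆ B) : energy p f B ≤ energy p f A := by
  have h := energy_sub_energy_union (p := p) f B A
  rw [Finset.union_eq_right.2 hB] at h
  linarith [mean_nonneg hp0 hp1 fun η => sq_nonneg (cexp p A (fun ζ => f ζ - cexp p B f ζ) η)]

/-- Chain rule for the variance along a rank function: each vertex `z` of `A` is resampled after
all the vertices of `T z`, which have larger rank. -/
theorem energy_sub_energy_union_le_sum (hp0 : 0 ≤ p) (hp1 : p ≤ 1) (f : (V → Bool) → ℝ)
    (T : V → Finset V) (r : V → ℕ) (hT : ∀ z, ∀ w ∈ T z, r z < r w) (B : Finset V) :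
    ∀ A : Finset V, (∀ z ∈ A, T z ⊆ A ∪ B) →
      energy p f B - energy p f (B ∪ A) ≤
        ∑ z ∈ A, (energy p f (T z) - energy p f (T z ∪ {z})) := by
  intro A
  induction A using Finset.strongInduction with
  | H A ih =>
    intro hA
    rcases A.eq_empty_or_nonempty with rfl | hne
    · simp
    obtain ⟨z, hz, hmin⟩ := Finset.exists_min_image A r hne
    have hsub : ∀ w ∈ A, T w ⊆ A.erase z ∪ B := by
      intro w hw v hv
      have hvz : v ≠ z := by
        rintro rfl
        exact absurd (hT w v hv) (not_lt.2 (hmin w hw))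
      simpa [hvz] using hA w hw hv
    have h1 := ih (A.erase z) (Finset.erase_ssubset hz)
      fun w hw => hsub w (Finset.mem_of_mem_erase hw)
    have h2 := energy_sub_energy_union_le hp0 hp1 f {z} (hsub z hz)
    have h3 : A.erase z ∪ B ∪ {z} = B ∪ A := by
      ext v
      by_cases hv : v = z <;> simp [hv, hz, or_comm]
    rw [h3, Finset.union_comm] at h2
    rw [← Finset.add_sum_erase A _ hz]
    linarith

/-- The variance at `x` of `μ_T(f)` is controlled by the constrained variance at `x` and by a
small multiple of an unconstrained one, if the constraint `c` has a small failure probability. -/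
theorem energy_sub_le_constrained (hp0 : 0 ≤ p) (hp1 : p ≤ 1) (f : (V → Bool) → ℝ) {x : V}
    {T B : Finset V} (hBT : B ⊆ T) (hxT : x ∉ T) {c : (V → Bool) → ℝ}
    (hc01 : ∀ η, c η = 0 ∨ c η = 1) (hcT : DependsOn c (↑(T \ B) : Set V)) {d : ℝ}
    (hd : mean p (fun η => 1 - c η) ≤ d) :
    energy p f T - energy p f (T ∪ {x}) ≤ 2 * mean p (fun η => c η * cvar p {x} f η) +
      2 * (d * (energy p f B - energy p f (B ∪ {x}))) := by
  have hcx : DependsOn c (↑({x} : Finset V) : Set V)ᶜ := hcT.mono fun y hy => by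
    simp only [Finset.coe_singleton, Set.mem_compl_iff, Set.mem_singleton_iff]
    rintro rfl
    exact hxT (Finset.mem_sdiff.1 hy).1
  have hcB : DependsOn (fun η => 1 - c η) (↑B : Set V)ᶜ := fun η η' h => by
    simp only [hcT fun y hy => h y (Finset.mem_sdiff.1 hy).2]
  have hcT' : DependsOn (fun η => 1 - c η) (↑T : Set V) := fun η η' h => by
    simp only [hcT fun y hy => h y (Finset.mem_sdiff.1 hy).1]
  rw [energy_sub_energy_union, energy_sub_energy_union]
  set D : (V → Bool) → ℝ := fun ζ => f ζ - cexp p {x} f ζ with hD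
  have hfirst : mean p (fun η => cexp p T (fun ζ => c ζ * D ζ) η ^ 2) ≤
      mean p (fun η => c η * cvar p {x} f η) := by
    refine (mean_cexp_sq_le hp0 hp1 T _).trans (le_of_eq ?_)
    refine Eq.trans ?_ (mean_mul_sq_sub_cexp hcx f)
    refine congrArg (mean p) (funext fun η => ?_)
    rcases hc01 η with h | h <;> simp [h, hD]
  have hsecond : mean p (fun η => cexp p T (fun ζ => (1 - c ζ) * D ζ) η ^ 2) ≤
      d * mean p (fun η => cexp p B D η ^ 2) := by
    have hTB : cexp p T (fun ζ => (1 - c ζ) * D ζ) =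
        cexp p T (fun ζ => (1 - c ζ) * cexp p B D ζ) := by
      rw [← Finset.union_eq_left.2 hBT, ← cexp_cexp, ← cexp_cexp]
      congr 1
      funext η
      rw [cexp_mul_of_dependsOn hcB, cexp_mul_of_dependsOn hcB, cexp_cexp, Finset.union_self]
    rw [hTB, ← mean_cexp T (fun η => cexp p B D η ^ 2), ← mean_const_mul]
    refine mean_mono hp0 hp1 fun η => (cexp_mul_sq_le hp0 hp1 T _ _ η).trans ?_
    refine mul_le_mul_of_nonneg_right ?_ ?_
    · have : (fun ζ => (1 - c ζ) ^ 2) = fun ζ => 1 - c ζ := by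
        funext ζ
        rcases hc01 ζ with h | h <;> simp [h]
      rw [this, cexp_eq_mean hcT']
      exact hd
    · simpa [cexp_one] using (sq_nonneg _).trans (cexp_mul_sq_le hp0 hp1 T (fun _ => 1) _ η)
  have hsplit : ∀ η, cexp p T D η ^ 2 ≤ 2 * cexp p T (fun ζ => c ζ * D ζ) η ^ 2 +
      2 * cexp p T (fun ζ => (1 - c ζ) * D ζ) η ^ 2 := fun η => by
    have h : cexp p T D η = cexp p T (fun ζ => c ζ * D ζ) η +
        cexp p T (fun ζ => (1 - c ζ) * D ζ) η := by
      rw [← cexp_add]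
      congr 1
      funext ζ
      ring
    rw [h]
    nlinarith [sq_nonneg (cexp p T (fun ζ => c ζ * D ζ) η -
      cexp p T (fun ζ => (1 - c ζ) * D ζ) η)]
  have h := mean_mono hp0 hp1 hsplit
  rw [mean_add, mean_const_mul, mean_const_mul] at h
  linarith

end Bernoulli

section Tree

variable {k n : ℕ}

theorem parent_unique {x x' y : TV k n} (h : childOf x y) (h' : childOf x' y) : x = x' := by
  obtain ⟨⟨m, hm⟩, w⟩ := x
  obtain ⟨⟨m', hm'⟩, w'⟩ := x'
  obtain ⟨e, he⟩ := h
  obtain ⟨e', he'⟩ := h'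
  obtain rfl : m = m' := by simp only at e e'; omega
  congr 1
  funext i
  exact (he i).symm.trans (he' i)

theorem card_children {x : TV k n} (hx : x.1.val < n) :
    (Finset.univ.filter fun y : TV k n => childOf x y).card = k := by
  have h : (Finset.univ : Finset (Fin k)).card =
      (Finset.univ.filter fun y : TV k n => childOf x y).card := by
    refine Finset.card_bij (fun a _ => (⟨⟨x.1.val + 1, by omega⟩,
      Fin.snoc (α := fun _ => Fin k) x.2 a⟩ : TV k n)) ?_ ?_ ?_
    · intro a _
      rw [Finset.mem_filter]
      exact ⟨Finset.mem_univ _, rfl, fun i => Fin.snoc_castSucc (α := fun _ => Fin k) a x.2 i⟩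
    · intro a _ b _ hab
      have := congrFun (eq_of_heq (Sigma.mk.inj hab).2) (Fin.last _)
      simpa using this
    · intro y hy
      obtain ⟨⟨m, hm⟩, w⟩ := y
      obtain ⟨e, he⟩ := (Finset.mem_filter.1 hy).2
      obtain rfl : m = x.1.val + 1 := e
      refine ⟨w (Fin.last _), Finset.mem_univ _, ?_⟩
      congr 1
      funext i
      refine Fin.lastCases ?_ (fun i => ?_) i
      · simp
      · rw [Fin.snoc_castSucc]
        exact (he i).symm
  rw [← h, Finset.card_univ, Fintype.card_fin]

/-- The vertices of the subtree rooted at `x`. -/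
def subtree (x : TV k n) : Finset (TV k n) :=
  Finset.univ.filter fun y => Relation.ReflTransGen childOf x y

/-- The vertices of the subtree rooted at `x` at distance at most `m` from `x`. -/
def subtreeUpTo (x : TV k n) (m : ℕ) : Finset (TV k n) :=
  (subtree x).filter fun y => y.1.val ≤ x.1.val + m

theorem mem_subtree {x y : TV k n} : y ∈ subtree x ↔ Relation.ReflTransGen childOf x y := by
  simp [subtree]

theorem mem_subtreeUpTo {x y : TV k n} {m : ℕ} :
    y ∈ subtreeUpTo x m ↔ y ∈ subtree x ∧ y.1.val ≤ x.1.val + m :=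
  Finset.mem_filter

theorem self_mem_subtree (x : TV k n) : x ∈ subtree x := mem_subtree.2 .refl

theorem self_mem_subtreeUpTo (x : TV k n) (m : ℕ) : x ∈ subtreeUpTo x m :=
  mem_subtreeUpTo.2 ⟨self_mem_subtree x, Nat.le_add_right _ _⟩

theorem subtree_trans {x y z : TV k n} (hy : y ∈ subtree x) (hz : z ∈ subtree y) :
    z ∈ subtree x :=
  mem_subtree.2 ((mem_subtree.1 hy).trans (mem_subtree.1 hz))

theorem eq_or_depth_lt_of_mem_subtree {x y : TV k n} (h : y ∈ subtree x) :
    x = y ∨ x.1.val < y.1.val := by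
  rw [mem_subtree] at h
  induction h with
  | refl => exact .inl rfl
  | tail _ hc ih =>
    have := hc.1
    rcases ih with rfl | ih
    · right; omega
    · right; omega

theorem eq_of_mem_subtree_of_depth_eq {x x' z : TV k n} (h : z ∈ subtree x)
    (h' : z ∈ subtree x') (hd : x.1.val = x'.1.val) : x = x' := by
  rw [mem_subtree] at h
  induction h with
  | refl =>
    rcases eq_or_depth_lt_of_mem_subtree h' with e | e
    · exact e.symm
    · omega
  | @tail b c hb hc ih =>
    have hlt : x.1.val < c.1.val := by
      have := hc.1
      rcases eq_or_depth_lt_of_mem_subtree (mem_subtree.2 hb) with rfl | e <;> omega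
    rcases (Relation.ReflTransGen.cases_tail_iff _ _ _).1 (mem_subtree.1 h') with rfl | ⟨b', hb', hc'⟩
    · omega
    · exact ih (mem_subtree.2 (parent_unique hc' hc ▸ hb'))

theorem card_ancestors_le (z : TV k n) (ℓ : ℕ) :
    (Finset.univ.filter fun x : TV k n => z ∈ subtreeUpTo x ℓ).card ≤ ℓ + 1 := by
  have h : (Finset.univ.filter fun x : TV k n => z ∈ subtreeUpTo x ℓ).card ≤
      (Finset.Icc (z.1.val - ℓ) z.1.val).card := by
    refine Finset.card_le_card_of_injOn (fun x => x.1.val) ?_ ?_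
    · intro x hx
      obtain ⟨hx, hd⟩ := mem_subtreeUpTo.1 (Finset.mem_filter.1 hx).2
      have := eq_or_depth_lt_of_mem_subtree hx
      rw [Finset.mem_coe, Finset.mem_Icc]
      rcases this with rfl | this <;> dsimp only <;> omega
    · intro x hx x' hx' hd
      exact eq_of_mem_subtree_of_depth_eq
        (mem_subtreeUpTo.1 (Finset.mem_filter.1 hx).2).1
        (mem_subtreeUpTo.1 (Finset.mem_filter.1 hx').2).1 hd
  rw [Nat.card_Icc] at h
  omega

theorem subtreeUpTo_succ_of_child {x y : TV k n} (h : childOf x y) (m : ℕ) :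
    subtreeUpTo y m ⊆ subtreeUpTo x (m + 1) := by
  intro z hz
  rw [mem_subtreeUpTo] at hz ⊢
  have := h.1
  exact ⟨subtree_trans (mem_subtree.2 (.single h)) hz.1, by omega⟩

variable {j : ℕ}

theorem bootO_eq_false_iff (η : TV k n → Bool) (x : TV k n) :
    bootO j η x = false ↔ η x = false ∨
      j ≤ ((Finset.univ.filter fun y => childOf x y).filter fun y => η y = false).card := by
  rw [Finset.filter_filter, bootO]
  split_ifs with h
  · exact iff_of_true rfl (by convert h)
  · exact iff_of_false (by decide) (by convert h)

theorem bootO_iterate_succ_eq_false_iff (m : ℕ) (η : TV k n → Bool) (x : TV k n) :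
    (bootO j)^[m + 1] η x = false ↔ η x = false ∨
      j ≤ ((Finset.univ.filter fun y => childOf x y).filter
        fun y => (bootO j)^[m] η y = false).card := by
  induction m with
  | zero => exact bootO_eq_false_iff η x
  | succ m ih =>
    rw [Function.iterate_succ_apply', bootO_eq_false_iff, ih, or_assoc]
    refine or_congr_right (or_iff_right_of_imp fun h => h.trans (Finset.card_le_card ?_))
    refine Finset.monotone_filter_right _ fun y _ hy => ?_
    rw [Function.iterate_succ_apply', bootO_eq_false_iff]
    exact .inl hy

theorem eq_false_of_bootO_iterate (m : ℕ) {η : TV k n → Bool} {x : TV k n} (h : η x = false) :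
    (bootO j)^[m] η x = false := by
  cases m with
  | zero => exact h
  | succ m => exact (bootO_iterate_succ_eq_false_iff m η x).2 (.inl h)

theorem dependsOn_bootO_iterate (m : ℕ) (x : TV k n) :
    DependsOn (fun η => (bootO j)^[m] η x) (↑(subtreeUpTo x m) : Set (TV k n)) := by
  induction m generalizing x with
  | zero => exact fun η η' h => h x (self_mem_subtreeUpTo x 0)
  | succ m ih =>
    intro η η' h
    have hch : ((Finset.univ.filter fun y => childOf x y).filter
        fun y => (bootO j)^[m] η y = false) = ((Finset.univ.filter fun y => childOf x y).filter
        fun y => (bootO j)^[m] η' y = false) := by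
      refine Finset.filter_congr fun y hy => ?_
      have : (bootO j)^[m] η y = (bootO j)^[m] η' y := ih y fun z hz =>
        h z (subtreeUpTo_succ_of_child (Finset.mem_filter.1 hy).2 m hz)
      rw [this]
    have key := (bootO_iterate_succ_eq_false_iff (j := j) m η x).trans
      (by rw [hch, h x (self_mem_subtreeUpTo x _), ← bootO_iterate_succ_eq_false_iff])
    exact Bool.eq_iff_iff.2 (by simpa using not_congr key)

variable {p : ℝ}

theorem mean_bootO_iterate (hjk : j ≤ k) (m : ℕ) (x : TV k n) (hx : x.1.val + m ≤ n) :
    mean p (fun η => if (bootO j)^[m] η x then 1 else 0) = (g k j p)^[m] p := by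
  have hbool : ∀ (a b : Bool) (c : ℕ), (a = false ↔ b = false ∨ ¬ c < j) →
      (if a then (1 : ℝ) else 0) = (if c < j then 1 else 0) * (if b then 1 else 0) := by
    intro a b c h
    by_cases hc : c < j <;> cases a <;> cases b <;> simp_all
  induction m generalizing x with
  | zero => exact mean_coordinate x
  | succ m ih =>
    set ch : Finset (TV k n) := Finset.univ.filter fun y => childOf x y with hch
    have hcard : ch.card = k := card_children (by omega)
    have hchild : ∀ y ∈ ch, childOf x y := fun y hy => (Finset.mem_filter.1 hy).2
    have hpt : ∀ η, (if (bootO j)^[m + 1] η x then (1 : ℝ) else 0) =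
        (if (ch.filter fun y => (bootO j)^[m] η y = false).card < j then 1 else 0) *
          (if η x then 1 else 0) := by
      intro η
      have h := bootO_iterate_succ_eq_false_iff (j := j) m η x
      rw [← hch, ← not_lt] at h
      exact hbool _ _ _ h
    have hloc : ∀ y ∈ ch, DependsOn (fun η => (bootO j)^[m] η y) (↑(subtree y) : Set (TV k n)) :=
      fun y _ => (dependsOn_bootO_iterate m y).mono fun z hz => (mem_subtreeUpTo.1 hz).1
    simp only [hpt]
    rw [mean_mul_of_dependsOn (A := {x}), mean_coordinate,
      mean_card_failures_lt ch subtree (fun y η => (bootO j)^[m] η y) hloc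
        (q := (g k j p)^[m] p), Function.iterate_succ_apply', hcard]
    · rw [g, mul_comm]
    · intro y hy y' hy' hne
      refine Finset.disjoint_left.2 fun z hz hz' => hne (eq_of_mem_subtree_of_depth_eq hz hz' ?_)
      rw [(hchild y hy).1, (hchild y' hy').1]
    · intro y hy
      exact ih y (by have := (hchild y hy).1; omega)
    · rw [hcard]
      exact hjk
    · intro η η' h
      simp only [h x (by simp)]
    · intro η η' h
      have : (ch.filter fun y => (bootO j)^[m] η y = false) =
          ch.filter fun y => (bootO j)^[m] η' y = false := by
        refine Finset.filter_congr fun y hy => ?_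
        have : (bootO j)^[m] η y = (bootO j)^[m] η' y := hloc y hy fun z hz => h z fun hzx => by
          rw [Finset.coe_singleton, Set.mem_singleton_iff] at hzx
          subst hzx
          have hc := (hchild y hy).1
          rcases eq_or_depth_lt_of_mem_subtree hz with rfl | hlt <;> omega
        rw [this]
      simp only [this]

variable {ℓ : ℕ}

theorem cEll_eq_zero_or_one (x : TV k n) (η : TV k n → Bool) :
    cEll j ℓ x η = 0 ∨ cEll j ℓ x η = 1 := by
  unfold cEll
  split_ifs <;> simp

theorem dependsOn_cEll (x : TV k n) :
    DependsOn (cEll j ℓ x) (↑(subtreeUpTo x ℓ \ {x}) : Set (TV k n)) := by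
  intro η η' h
  have key : (bootO j)^[ℓ] (Function.update η x true) x =
      (bootO j)^[ℓ] (Function.update η' x true) x :=
    dependsOn_bootO_iterate ℓ x fun y hy => by
      by_cases hyx : y = x
      · simp [hyx]
      · simpa [hyx] using h y (by simpa [hyx] using hy)
  simp only [cEll, key]

theorem mean_one_sub_cEll_le (hp : 0 < p) (hjk : j ≤ k) (x : TV k n) :
    mean p (fun η => 1 - cEll j ℓ x η) ≤ max 0 ((g k j p)^[ℓ] p / p) := by
  by_cases hx : n - x.1.val < ℓ
  · simp [cEll, hx, mean_const]
  · refine le_max_of_le_right (le_of_eq ?_)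
    have hxn : x.1.val ≤ n := Nat.lt_succ_iff.1 x.1.isLt
    rw [eq_div_iff hp.ne', ← mean_bootO_iterate hjk ℓ x (by omega)]
    nth_rewrite 2 [← mean_coordinate (p := p) x]
    rw [← mean_mul_of_dependsOn (A := {x})]
    · refine congrArg (mean p) (funext fun η => ?_)
      cases h : η x
      · simp [eq_false_of_bootO_iterate ℓ h]
      · rw [cEll, if_neg hx, Function.update_eq_self_iff.2 h.symm]
        cases (bootO j)^[ℓ] η x <;> simp
    · intro η η' h
      simp only [h x (by simp)]
    · intro η η' h
      exact congrArg (1 - ·) (dependsOn_cEll x fun y hy =>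
        h y (by simpa using (Finset.mem_sdiff.1 hy).2))

end Tree

theorem longrange_poincare (k j ℓ : ℕ) (p : ℝ) (hk : 2 ≤ k) (hj : 2 ≤ j) (hjk : j ≤ k)
    (hp : p ∈ Set.Ioo (0 : ℝ) 1) (hl : 1 ≤ ℓ)
    (hδ : ((ℓ : ℝ) + 1) * ((g k j p)^[ℓ] p / p) ≤ 1 / 4) :
    ∀ (n : ℕ) (f : (TV k n → Bool) → ℝ),
      varTot p f ≤ 8 * ∑ x : TV k n, mean p (fun η => cEll j ℓ x η * cvar p {x} f η) := by
  intro n f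
  obtain ⟨hp0, hp1⟩ := hp
  set δ : ℝ := max 0 ((g k j p)^[ℓ] p / p) with hδ_def
  have hδ0 : 0 ≤ δ := le_max_left _ _
  have hδ' : ((ℓ : ℝ) + 1) * δ ≤ 1 / 4 := by
    rw [hδ_def, mul_max_of_nonneg _ _ (by positivity)]
    exact max_le (by norm_num) hδ
  set T : TV k n → Finset (TV k n) := fun x => subtree x \ {x} with hT_def
  set A : TV k n → Finset (TV k n) := fun x => subtreeUpTo x ℓ with hA_def
  set B : TV k n → Finset (TV k n) := fun x => subtree x \ A x with hB_def
  set S : TV k n → ℝ := fun x => energy p f (T x) - energy p f (T x ∪ {x}) with hS_def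
  set D : TV k n → ℝ := fun x => mean p (fun η => cEll j ℓ x η * cvar p {x} f η) with hD_def
  have hS0 : ∀ x, 0 ≤ S x := fun x =>
    sub_nonneg.2 (energy_antitone hp0.le hp1.le f Finset.subset_union_left)
  have hrank : ∀ z, ∀ w ∈ T z, z.1.val < w.1.val := by
    intro z w hw
    rw [hT_def, Finset.mem_sdiff, Finset.mem_singleton] at hw
    exact (eq_or_depth_lt_of_mem_subtree hw.1).resolve_left (Ne.symm hw.2)
  have hchain := energy_sub_energy_union_le_sum hp0.le hp1.le f T (fun z => z.1.val) hrank
  have hvar : varTot p f ≤ ∑ x, S x := by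
    have h := hchain ∅ Finset.univ fun z _ => by simp
    rwa [Finset.empty_union, ← varTot_eq_energy_sub] at h
  have hlocal : ∀ x, S x ≤ 2 * D x + 2 * (δ * ∑ z ∈ A x, S z) := by
    intro x
    have hxA : x ∈ A x := self_mem_subtreeUpTo x ℓ
    have hBT : B x ⊆ T x := Finset.sdiff_subset_sdiff subset_rfl (by simpa using hxA)
    have h := energy_sub_le_constrained hp0.le hp1.le f hBT (x := x) (by simp [hT_def])
      (cEll_eq_zero_or_one (j := j) (ℓ := ℓ) x) ((dependsOn_cEll x).mono fun y hy => ?_)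
      (mean_one_sub_cEll_le hp0 hjk x)
    · refine h.trans ?_
      have h1 : energy p f (B x) - energy p f (B x ∪ {x}) ≤ ∑ z ∈ A x, S z := by
        refine le_trans ?_ (hchain (B x) (A x) fun z hz w hw => ?_)
        · exact sub_le_sub_left (energy_antitone hp0.le hp1.le f
            (Finset.union_subset_union_right (by simpa using hxA))) _
        · have hw' : w ∈ subtree x :=
            subtree_trans (mem_subtreeUpTo.1 hz).1 (Finset.mem_sdiff.1 hw).1
          by_cases hwA : w ∈ A x <;> simp [hB_def, hwA, hw']
      have := mul_le_mul_of_nonneg_left h1 hδ0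
      linarith
    · have hy' := Finset.mem_sdiff.1 hy
      have hyx : y ∈ subtree x := (mem_subtreeUpTo.1 hy'.1).1
      simp only [hT_def, hB_def, hA_def, Finset.coe_sdiff, Set.mem_sdiff, Finset.mem_coe]
      exact ⟨⟨hyx, hy'.2⟩, fun h => h.2 hy'.1⟩
  have hcount : ∑ x, ∑ z ∈ A x, S z ≤ ((ℓ : ℝ) + 1) * ∑ z, S z := by
    rw [Finset.sum_comm' (t' := Finset.univ)
      (s' := fun z => Finset.univ.filter fun x => z ∈ A x) (by simp), Finset.mul_sum]
    refine Finset.sum_le_sum fun z _ => ?_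
    rw [Finset.sum_const, nsmul_eq_mul]
    exact mul_le_mul_of_nonneg_right (by exact_mod_cast card_ancestors_le z ℓ) (hS0 z)
  have hsum : ∑ x, S x ≤ 2 * ∑ x, D x + 2 * (δ * ∑ x, ∑ z ∈ A x, S z) := by
    simp only [Finset.mul_sum, ← Finset.sum_add_distrib]
    exact Finset.sum_le_sum fun x _ => by simpa only [Finset.mul_sum] using hlocal x
  have hS : 0 ≤ ∑ x, S x := Finset.sum_nonneg fun x _ => hS0 x
  have h1 := mul_le_mul_of_nonneg_left hcount hδ0
  have h2 := mul_le_mul_of_nonneg_right hδ' hS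
  change varTot p f ≤ 8 * ∑ x, D x
  linarith
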